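/- Let n ≥ 2, let Ω ⊂ ℝ^n be a bounded domain, and let H satisfy Conditions A, B, C with k ≥ 1. Let h ∈ C(P_∞) satisfy 0 < inf_{P_∞} h ≤ sup_{P_∞} h < ∞. Let u be upper semicontinuous on Ω_∞ ∪ P_∞ with u > 0, a viscosity subsolution of Γ_k[u] = H(Du,D²u) − u^{k−1}u_t = 0 in Ω_∞, with u ≤ h on P_∞ and u = h on ∂Ω × [T,∞) for some T > 0. Set μ_sup = lim_{t→∞} ( sup_{∂Ω × [t,∞)} h ). Then lim_{t→∞} ( sup_{cl(Ω) × [t,∞)} u ) = μ_sup. -/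

import Mathlib

open Set Filter Metric

noncomputable section

namespace DNLP

/-- Euclidean space ℝⁿ. -/
abbrev En (n : ℕ) := EuclideanSpace ℝ (Fin n)

/-- n×n real matrices (we use these for the symmetric matrices Sⁿ). -/
abbrev Sym (n : ℕ) := Matrix (Fin n) (Fin n) ℝ

variable {n : ℕ}

/-- Loewner order: X ≤ Y iff Y − X is positive semidefinite. -/
def LoewnerLE (X Y : Sym n) : Prop := (Y - X).PosSemidef

/-- Rank-one matrix p ⊗ q with entries pᵢ qⱼ. -/
def vouter (p q : En n) : Sym n := Matrix.of fun i j => p i * q j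

/-- Spatial gradient of ψ(·,t) at y. -/
def sgrad (ψ : En n → ℝ → ℝ) (y : En n) (t : ℝ) : En n :=
  gradient (fun x => ψ x t) y

/-- Spatial Hessian matrix of ψ(·,t) at y. -/
def shess (ψ : En n → ℝ → ℝ) (y : En n) (t : ℝ) : Sym n :=
  Matrix.of fun i j =>
    fderiv ℝ (fun x => fderiv ℝ (fun x' => ψ x' t) x (EuclideanSpace.single j (1:ℝ))) y
      (EuclideanSpace.single i (1:ℝ))

/-- Time derivative ψ_t at (y,t). -/
def tpartial (ψ : En n → ℝ → ℝ) (y : En n) (t : ℝ) : ℝ := deriv (fun s => ψ y s) t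

/-- Test functions: C² in x and C¹ in t. -/
def IsTestFn (ψ : En n → ℝ → ℝ) : Prop :=
  (∀ t, ContDiff ℝ 2 fun x => ψ x t) ∧ (∀ x, ContDiff ℝ 1 fun s => ψ x s)

/-- Condition A: continuity, H(p,0)=0 and degenerate ellipticity (monotonicity). -/
def CondA (H : En n → Sym n → ℝ) : Prop :=
  Continuous (fun q : En n × Sym n => H q.1 q.2) ∧
  (∀ p, H p 0 = 0) ∧
  ∀ (p : En n) (X Y : Sym n), LoewnerLE X Y → H p X ≤ H p Y

/-- Condition B: homogeneity of degree k₁ in the gradient and degree 1 in the Hessian. -/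
def CondB (H : En n → Sym n → ℝ) (k₁ : ℝ) : Prop :=
  0 ≤ k₁ ∧
  (∀ (θ : ℝ) (p : En n) (X : Sym n), H (θ • p) X = |θ| ^ k₁ * H p X) ∧
  ∀ (θ : ℝ), 0 < θ → ∀ (p : En n) (X : Sym n), H p (θ • X) = θ * H p X

/-- Condition C (coercivity): m(Λ) > 0 for Λ < 1 and M(Λ) < 0 for Λ ≥ Λ₁, expressed
pointwise over unit vectors (equivalent by compactness of the sphere and continuity). -/
def CondC (H : En n → Sym n → ℝ) : Prop :=
  (∀ Λ : ℝ, Λ < 1 → ∀ e : En n, ‖e‖ = 1 →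
      0 < H e (1 - Λ • vouter e e) ∧ H e (Λ • vouter e e - 1) < 0) ∧
  ∃ Λ₁ : ℝ, 1 ≤ Λ₁ ∧ ∀ Λ : ℝ, Λ₁ ≤ Λ → ∀ e : En n, ‖e‖ = 1 →
      H e (1 - Λ • vouter e e) < 0 ∧ 0 < H e (Λ • vouter e e - 1)

/-- Viscosity supersolution of H(Du,D²u) − u^{k−1} u_t = 0 on the set Q (Γ_k[u] ≤ 0). -/
def ParSuper (H : En n → Sym n → ℝ) (k : ℝ) (Q : Set (En n × ℝ)) (u : En n → ℝ → ℝ) : Prop :=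
  ∀ ψ : En n → ℝ → ℝ, IsTestFn ψ → ∀ y t, (y, t) ∈ Q →
    IsLocalMinOn (fun p : En n × ℝ => u p.1 p.2 - ψ p.1 p.2) Q (y, t) →
    H (sgrad ψ y t) (shess ψ y t) - u y t ^ (k - 1) * tpartial ψ y t ≤ 0

/-- Viscosity subsolution of H(Du,D²u) − u^{k−1} u_t = 0 on the set Q (Γ_k[u] ≥ 0). -/
def ParSub (H : En n → Sym n → ℝ) (k : ℝ) (Q : Set (En n × ℝ)) (u : En n → ℝ → ℝ) : Prop :=
  ∀ ψ : En n → ℝ → ℝ, IsTestFn ψ → ∀ y t, (y, t) ∈ Q →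
    IsLocalMaxOn (fun p : En n × ℝ => u p.1 p.2 - ψ p.1 p.2) Q (y, t) →
    0 ≤ H (sgrad ψ y t) (shess ψ y t) - u y t ^ (k - 1) * tpartial ψ y t

/-- The parabolic cylinder Ω_T = Ω × (0,T). -/
def pcyl (Ω : Set (En n)) (T : ℝ) : Set (En n × ℝ) := Ω ×ˢ Ioo 0 T

/-- The parabolic boundary P_T = (cl(Ω) × {0}) ∪ (∂Ω × [0,T)). -/
def pbdry (Ω : Set (En n)) (T : ℝ) : Set (En n × ℝ) :=
  (closure Ω ×ˢ ({0} : Set ℝ)) ∪ (frontier Ω ×ˢ Ico 0 T)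

/-- Ω_∞ = Ω × (0,∞). -/
def pcylInf (Ω : Set (En n)) : Set (En n × ℝ) := Ω ×ˢ Ioi 0

/-- P_∞ = (cl(Ω) × {0}) ∪ (∂Ω × [0,∞)). -/
def pbdryInf (Ω : Set (En n)) : Set (En n × ℝ) :=
  (closure Ω ×ˢ ({0} : Set ℝ)) ∪ (frontier Ω ×ˢ Ici 0)

/-- Viscosity subsolution of F(t,Du,D²u + Du⊗Du) − f(t) u_t = 0 on Q. -/
def ParSubF (F : ℝ → En n → Sym n → ℝ) (f : ℝ → ℝ) (Q : Set (En n × ℝ))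
    (u : En n → ℝ → ℝ) : Prop :=
  ∀ ψ : En n → ℝ → ℝ, IsTestFn ψ → ∀ y t, (y, t) ∈ Q →
    IsLocalMaxOn (fun p : En n × ℝ => u p.1 p.2 - ψ p.1 p.2) Q (y, t) →
    0 ≤ F t (sgrad ψ y t) (shess ψ y t + vouter (sgrad ψ y t) (sgrad ψ y t))
        - f t * tpartial ψ y t

/-- Viscosity supersolution of F(t,Du,D²u + Du⊗Du) − f(t) u_t = 0 on Q. -/
def ParSuperF (F : ℝ → En n → Sym n → ℝ) (f : ℝ → ℝ) (Q : Set (En n × ℝ))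
    (u : En n → ℝ → ℝ) : Prop :=
  ∀ ψ : En n → ℝ → ℝ, IsTestFn ψ → ∀ y t, (y, t) ∈ Q →
    IsLocalMinOn (fun p : En n × ℝ => u p.1 p.2 - ψ p.1 p.2) Q (y, t) →
    F t (sgrad ψ y t) (shess ψ y t + vouter (sgrad ψ y t) (sgrad ψ y t))
        - f t * tpartial ψ y t ≤ 0

/-- Viscosity subsolution of H(Dw, D²w + Dw⊗Dw) − w_t = 0 on Q. -/
def ParSubLog (H : En n → Sym n → ℝ) (Q : Set (En n × ℝ)) (w : En n → ℝ → ℝ) : Prop :=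
  ParSubF (fun _ p X => H p X) (fun _ => 1) Q w

/-- Viscosity supersolution of H(Dw, D²w + Dw⊗Dw) − w_t = 0 on Q. -/
def ParSuperLog (H : En n → Sym n → ℝ) (Q : Set (En n × ℝ)) (w : En n → ℝ → ℝ) : Prop :=
  ParSuperF (fun _ p X => H p X) (fun _ => 1) Q w

/-- Hessian matrix of φ : ℝⁿ → ℝ at y. -/
def ehess (φ : En n → ℝ) (y : En n) : Sym n :=
  Matrix.of fun i j =>
    fderiv ℝ (fun x => fderiv ℝ φ x (EuclideanSpace.single j (1:ℝ))) y
      (EuclideanSpace.single i (1:ℝ))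

/-- Elliptic viscosity condition H(Du,D²u) ≥ f in Ω (subsolution). -/
def EllSub (H : En n → Sym n → ℝ) (Ω : Set (En n)) (u : En n → ℝ) (f : En n → ℝ) : Prop :=
  ∀ φ : En n → ℝ, ContDiff ℝ 2 φ → ∀ y ∈ Ω,
    IsLocalMaxOn (fun x => u x - φ x) Ω y →
    f y ≤ H (gradient φ y) (ehess φ y)

/-- Elliptic viscosity condition H(Dv,D²v) ≤ f in Ω (supersolution). -/
def EllSuper (H : En n → Sym n → ℝ) (Ω : Set (En n)) (v : En n → ℝ) (f : En n → ℝ) : Prop :=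
  ∀ φ : En n → ℝ, ContDiff ℝ 2 φ → ∀ y ∈ Ω,
    IsLocalMinOn (fun x => v x - φ x) Ω y →
    H (gradient φ y) (ehess φ y) ≤ f y

/-- Uniform outer ball condition. -/
def UnifOuterBall (Ω : Set (En n)) : Prop :=
  ∃ ρ₀ : ℝ, 0 < ρ₀ ∧ ∀ y ∈ frontier Ω, ∃ q : En n,
    q ∉ Ω ∧ Metric.ball q ρ₀ ⊆ Ωᶜ ∧ y ∈ Metric.sphere q ρ₀

/-- Outer ball condition (radius may vary with the boundary point). -/
def OuterBallCond (Ω : Set (En n)) : Prop :=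
  ∀ y ∈ frontier Ω, ∃ ρ : ℝ, 0 < ρ ∧ ∃ q : En n,
    q ∉ Ω ∧ Metric.ball q ρ ⊆ Ωᶜ ∧ y ∈ Metric.sphere q ρ

theorem hasFDerivAt_quadratic_barrier (c s V γ : ℝ) (z x : En n) :
    HasFDerivAt (fun x' : En n => c + s * (V - ‖x' - z‖ ^ 2) + γ)
      (innerSL ℝ ((-2 * s) • (x - z))) x := by
  have h1 : HasFDerivAt (fun x' : En n => x' - z) (ContinuousLinearMap.id ℝ (En n)) x :=
    (hasFDerivAt_id x).sub_const z
  have h2 := ((((h1.norm_sq).const_sub V).const_mul s).const_add c).add_const γ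
  refine h2.congr_fderiv ?_
  ext w
  simp only [neg_smul, smul_neg, neg_mul]
  simp
  ring

theorem sgrad_quadratic_barrier (c s V : ℝ) (z y : En n) (g : ℝ → ℝ) (t : ℝ) :
    sgrad (fun x t => c + s * (V - ‖x - z‖ ^ 2) + g t) y t = s • ((-2 : ℝ) • (y - z)) := by
  have h1 := (hasFDerivAt_quadratic_barrier c s V (g t) z y).hasGradientAt
  unfold sgrad
  rw [h1.gradient, smul_smul, mul_comm s]
  exact (InnerProductSpace.toDual ℝ (En n)).symm_apply_apply _

theorem shess_quadratic_barrier (c s V : ℝ) (z y : En n) (g : ℝ → ℝ) (t : ℝ) :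
    shess (fun x t => c + s * (V - ‖x - z‖ ^ 2) + g t) y t = s • ((-2 : ℝ) • (1 : Sym n)) := by
  ext i j
  have h1 : (fun x => fderiv ℝ (fun x' : En n => c + s * (V - ‖x' - z‖ ^ 2) + g t) x
      (EuclideanSpace.single j (1 : ℝ))) = fun x => (-2 * s) * (x j - z j) := by
    funext x
    rw [(hasFDerivAt_quadratic_barrier c s V (g t) z x).fderiv]
    simp [EuclideanSpace.inner_single_right]
  have h2 : HasFDerivAt (fun x : En n => (-2 * s) * (x j - z j))
      ((-2 * s) • (EuclideanSpace.proj j : En n →L[ℝ] ℝ)) y :=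
    ((EuclideanSpace.proj j : En n →L[ℝ] ℝ).hasFDerivAt.sub_const (z j)).const_mul (-2 * s)
  simp only [shess, Matrix.of_apply]
  rw [h1, h2.fderiv]
  by_cases hij : i = j
  · subst hij; simp [mul_comm]
  · simp [hij, Ne.symm hij]

/-- Away from its vertex, a concave paraboloid is a strict supersolution. -/
theorem H_paraboloid_neg {H : En n → Sym n → ℝ} {k₁ : ℝ} (hB : CondB H k₁) (hC : CondC H)
    {p : En n} (hp : p ≠ 0) : H p ((-2 : ℝ) • (1 : Sym n)) < 0 := by
  have hp' : 0 < ‖p‖ := norm_pos_iff.mpr hp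
  set e : En n := ‖p‖⁻¹ • p with he
  have hne : ‖e‖ = 1 := norm_smul_inv_norm (𝕜 := ℝ) hp
  have hpe : p = ‖p‖ • e := by rw [he, smul_smul, mul_inv_cancel₀ hp'.ne', one_smul]
  have hX : (-2 : ℝ) • (1 : Sym n) = (2 : ℝ) • ((0 : ℝ) • vouter e e - 1) := by
    rw [zero_smul, zero_sub, smul_neg, neg_smul]
  have hneg := (hC.1 0 one_pos e hne).2
  rw [hpe, hX, hB.2.1, hB.2.2 2 two_pos, abs_of_pos hp']
  exact mul_neg_of_pos_of_neg (Real.rpow_pos_of_pos hp' _) (by linarith)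

theorem exists_strict_barrier (hn : 2 ≤ n) {H : En n → Sym n → ℝ} {k₁ : ℝ}
    (hA : CondA H) (hB : CondB H k₁) (hC : CondC H) {Ω : Set (En n)}
    (hΩb : Bornology.IsBounded Ω) :
    ∃ (z : En n) (V δ : ℝ), 0 < V ∧ 0 < δ ∧ ∀ x ∈ closure Ω, ‖x - z‖ ^ 2 ≤ V ∧
      H ((-2 : ℝ) • (x - z)) ((-2 : ℝ) • (1 : Sym n)) ≤ -δ := by
  have : Nonempty (Fin n) := ⟨⟨0, by omega⟩⟩
  have hK : IsCompact (closure Ω) := hΩb.isCompact_closure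
  obtain ⟨R, hR⟩ := hK.isBounded.exists_norm_le
  obtain ⟨z, hz⟩ := NormedSpace.exists_lt_norm ℝ (En n) R
  have hzn : ∀ x ∈ closure Ω, x - z ≠ 0 := fun x hx h0 => by
    rw [sub_eq_zero] at h0
    exact absurd (hR x hx) (by rw [h0]; exact hz.not_ge)
  have hcont : Continuous fun x : En n => H ((-2 : ℝ) • (x - z)) ((-2 : ℝ) • (1 : Sym n)) :=
    hA.1.comp (f := fun x : En n => ((-2 : ℝ) • (x - z), (-2 : ℝ) • (1 : Sym n))) (by fun_prop)
  rcases (closure Ω).eq_empty_or_nonempty with hemp | hne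
  · exact ⟨z, 1, 1, one_pos, one_pos, by simp [hemp]⟩
  obtain ⟨x₀, hx₀, hmax⟩ := hK.exists_isMaxOn hne hcont.continuousOn
  obtain ⟨x₁, -, hmax₁⟩ := hK.exists_isMaxOn hne
    (f := fun x : En n => ‖x - z‖ ^ 2) (by fun_prop)
  refine ⟨z, ‖x₁ - z‖ ^ 2 + 1, -H ((-2 : ℝ) • (x₀ - z)) ((-2 : ℝ) • (1 : Sym n)),
    by positivity, ?_, fun x hx => ⟨?_, ?_⟩⟩
  · have := H_paraboloid_neg hB hC (smul_ne_zero (by norm_num : (-2 : ℝ) ≠ 0) (hzn x₀ hx₀))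
    linarith
  · have : ‖x - z‖ ^ 2 ≤ ‖x₁ - z‖ ^ 2 := hmax₁ hx
    linarith
  · rw [neg_neg]; exact hmax hx

theorem pcylInf_union_pbdryInf {Ω : Set (En n)} :
    pcylInf Ω ∪ pbdryInf Ω = closure Ω ×ˢ Ici (0 : ℝ) := by
  ext ⟨x, t⟩
  have hcl : x ∈ closure Ω ↔ x ∈ Ω ∨ x ∈ frontier Ω := by
    rw [closure_eq_self_union_frontier]; rfl
  simp only [pcylInf, pbdryInf, mem_union, mem_prod, mem_Ioi, mem_singleton_iff, mem_Ici, hcl]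
  constructor
  · rintro (⟨h1, h2⟩ | ⟨h1, h2⟩ | ⟨h1, h2⟩)
    · exact ⟨Or.inl h1, h2.le⟩
    · exact ⟨h1, h2.ge⟩
    · exact ⟨Or.inr h1, h2⟩
  · rintro ⟨h1 | h1, h2⟩
    · rcases eq_or_lt_of_le h2 with h3 | h3
      · exact Or.inr (Or.inl ⟨Or.inl h1, h3.symm⟩)
      · exact Or.inl ⟨h1, h3⟩
    · exact Or.inr (Or.inr ⟨h1, h2⟩)

/-- Comparison of a subsolution with the barrier `c + s (V - |x - z|²) + g(t)`. -/
theorem le_quadratic_barrier {H : En n → Sym n → ℝ} {k₁ k : ℝ} (hk : k = k₁ + 1)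
    (hB : CondB H k₁) {Ω : Set (En n)} (hΩo : IsOpen Ω) (hΩb : Bornology.IsBounded Ω)
    {u : En n → ℝ → ℝ}
    (husc : UpperSemicontinuousOn (fun q : En n × ℝ => u q.1 q.2) (closure Ω ×ˢ Ici (0 : ℝ)))
    (hsub : ParSub H k (pcylInf Ω) u)
    {z : En n} {V δ : ℝ} (hbar : ∀ x ∈ closure Ω, ‖x - z‖ ^ 2 ≤ V ∧
      H ((-2 : ℝ) • (x - z)) ((-2 : ℝ) • (1 : Sym n)) ≤ -δ)
    {a b c s : ℝ} (ha : 0 ≤ a) (hs : 0 < s) {g : ℝ → ℝ}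
    (hg : ContDiff ℝ 1 g) (hg0 : ∀ t ∈ Icc a b, 0 ≤ g t)
    (hlat : ∀ x ∈ frontier Ω, ∀ t ∈ Icc a b, u x t ≤ c)
    (hua : ∀ x ∈ closure Ω, u x a ≤ c + g a) (hub : ∀ x ∈ closure Ω, u x b ≤ c + g b)
    (hstrict : ∀ x ∈ Ω, ∀ t ∈ Ioo a b, u x t ^ (k - 1) * (-deriv g t) < s ^ k * δ) :
    ∀ x ∈ closure Ω, ∀ t ∈ Icc a b, u x t ≤ c + s * (V - ‖x - z‖ ^ 2) + g t := by
  intro x hx t ht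
  set ψ : En n → ℝ → ℝ := fun x t => c + s * (V - ‖x - z‖ ^ 2) + g t with hψ
  have hv : ∀ x ∈ closure Ω, 0 ≤ s * (V - ‖x - z‖ ^ 2) := fun x hx =>
    mul_nonneg hs.le (sub_nonneg.mpr (hbar x hx).1)
  have hK : IsCompact (closure Ω ×ˢ Icc a b) := hΩb.isCompact_closure.prod isCompact_Icc
  have hKsub : closure Ω ×ˢ Icc a b ⊆ closure Ω ×ˢ Ici (0 : ℝ) :=
    prod_mono Subset.rfl fun τ hτ => ha.trans hτ.1
  have hψc : Continuous fun q : En n × ℝ => -ψ q.1 q.2 := by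
    have := hg.continuous
    simp only [hψ]
    fun_prop
  have hdiff : UpperSemicontinuousOn (fun q : En n × ℝ => u q.1 q.2 + -ψ q.1 q.2)
      (closure Ω ×ˢ Icc a b) :=
    (husc.mono hKsub).add (hψc.upperSemicontinuous.upperSemicontinuousOn _)
  obtain ⟨⟨y, τ⟩, ⟨hy, hτ⟩, hmax⟩ := hdiff.exists_isMaxOn
    (⟨(x, t), hx, ht⟩ : (closure Ω ×ˢ Icc a b).Nonempty) hK
  by_contra! hcon
  have hpos : 0 < u y τ + -ψ y τ := by
    have h1 : u x t + -ψ x t ≤ u y τ + -ψ y τ := hmax (a := (x, t)) ⟨hx, ht⟩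
    have h2 : ψ x t < u x t := hcon
    linarith
  have hψy : ψ y τ = c + s * (V - ‖y - z‖ ^ 2) + g τ := rfl
  have hvy := hv y hy
  have hyΩ : y ∈ Ω := by
    by_contra hyn
    have hyf : y ∈ frontier Ω := by rw [hΩo.frontier_eq]; exact ⟨hy, hyn⟩
    have := hlat y hyf τ hτ
    have := hg0 τ hτ
    linarith
  have hτa : a < τ := lt_of_le_of_ne hτ.1 fun h0 => by
    subst h0; have := hua y hy; linarith
  have hτb : τ < b := lt_of_le_of_ne hτ.2 fun h0 => by
    subst h0; have := hub y hy; linarith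
  have htest : IsTestFn ψ := by
    constructor
    · intro t
      have : ContDiff ℝ 2 fun x : En n => ‖x - z‖ ^ 2 :=
        (contDiff_id.sub contDiff_const).norm_sq ℝ
      exact (contDiff_const.add (contDiff_const.mul (contDiff_const.sub this))).add contDiff_const
    · intro x
      exact contDiff_const.add hg
  have hloc : IsLocalMaxOn (fun p : En n × ℝ => u p.1 p.2 - ψ p.1 p.2) (pcylInf Ω) (y, τ) := by
    refine Filter.Eventually.filter_mono nhdsWithin_le_nhds ?_
    filter_upwards [(hΩo.prod isOpen_Ioo).mem_nhds (⟨hyΩ, hτa, hτb⟩ : (y, τ) ∈ Ω ×ˢ Ioo a b)]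
      with q hq
    have := hmax (a := q) ⟨subset_closure hq.1, hq.2.1.le, hq.2.2.le⟩
    simpa [sub_eq_add_neg] using this
  have hvis := hsub ψ htest y τ ⟨hyΩ, ha.trans_lt hτa⟩ hloc
  have htd : tpartial ψ y τ = deriv g τ := by
    simp only [tpartial, hψ]
    exact deriv_const_add _
  have hHs : H (s • ((-2 : ℝ) • (y - z))) (s • ((-2 : ℝ) • (1 : Sym n)))
      = s ^ k * H ((-2 : ℝ) • (y - z)) ((-2 : ℝ) • (1 : Sym n)) := by
    rw [hB.2.1, hB.2.2 s hs, abs_of_pos hs, hk, Real.rpow_add_one hs.ne', mul_assoc]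
  rw [hψ, sgrad_quadratic_barrier, shess_quadratic_barrier, ← hψ, htd, hHs] at hvis
  have h1 := hstrict y hyΩ τ ⟨hτa, hτb⟩
  have h2 := mul_le_mul_of_nonneg_left (hbar y hy).2 (Real.rpow_nonneg hs.le k)
  linarith

/-- Maximum principle: a subsolution is bounded by its bound on the parabolic boundary. -/
theorem le_of_le_on_pbdryInf {H : En n → Sym n → ℝ} {k₁ k : ℝ} (hk : k = k₁ + 1)
    (hB : CondB H k₁) {Ω : Set (En n)} (hΩo : IsOpen Ω) (hΩb : Bornology.IsBounded Ω)
    {u : En n → ℝ → ℝ}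
    (husc : UpperSemicontinuousOn (fun q : En n × ℝ => u q.1 q.2) (closure Ω ×ˢ Ici (0 : ℝ)))
    (hupos : ∀ x ∈ closure Ω, ∀ t, 0 ≤ t → 0 < u x t)
    (hsub : ParSub H k (pcylInf Ω) u)
    {z : En n} {V δ : ℝ} (hV : 0 < V) (hδ : 0 < δ) (hbar : ∀ x ∈ closure Ω, ‖x - z‖ ^ 2 ≤ V ∧
      H ((-2 : ℝ) • (x - z)) ((-2 : ℝ) • (1 : Sym n)) ≤ -δ)
    {M : ℝ} (hM0 : 0 ≤ M) (hM : ∀ q ∈ pbdryInf Ω, u q.1 q.2 ≤ M) :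
    ∀ x ∈ closure Ω, ∀ t, 0 ≤ t → u x t ≤ M := by
  intro x hx t ht
  have hK : IsCompact (closure Ω ×ˢ Icc 0 (t + 1)) := hΩb.isCompact_closure.prod isCompact_Icc
  have hKsub : closure Ω ×ˢ Icc 0 (t + 1) ⊆ closure Ω ×ˢ Ici (0 : ℝ) :=
    prod_mono Subset.rfl fun τ hτ => hτ.1
  obtain ⟨⟨y, τ⟩, ⟨hy, hτ⟩, hmax⟩ := (husc.mono hKsub).exists_isMaxOn
    (⟨(x, t), hx, ht, by linarith⟩ : (closure Ω ×ˢ Icc 0 (t + 1)).Nonempty) hK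
  set B := u y τ with hBdef
  have hBpos : 0 < B := hupos y hy τ hτ.1
  have hle : ∀ s A : ℝ, 0 < s → 0 ≤ A → u x t ≤ M + s * V + B * Real.exp (-A) := by
    intro s A hs hA
    have hgd : ∀ r : ℝ, HasDerivAt (fun r => B * Real.exp (A * (r - (t + 1))))
        (B * (Real.exp (A * (r - (t + 1))) * A)) r := fun r => by
      have h1 : HasDerivAt (fun r : ℝ => A * (r - (t + 1))) A r := by
        simpa using ((hasDerivAt_id r).sub_const (t + 1)).const_mul A
      exact h1.exp.const_mul B
    have hcmp := le_quadratic_barrier hk hB hΩo hΩb husc hsub hbar (a := 0) (b := t + 1)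
      (c := M) (s := s) le_rfl hs (g := fun r => B * Real.exp (A * (r - (t + 1))))
      (by fun_prop) (fun r _ => by positivity)
      (fun x hx r hr => hM (x, r) (Or.inr ⟨hx, hr.1⟩))
      (fun x hx => (hM (x, 0) (Or.inl ⟨hx, rfl⟩)).trans (le_add_of_nonneg_right (by positivity)))
      (fun x hx => by
        have : u x (t + 1) ≤ B := hmax (a := (x, t + 1)) ⟨hx, by linarith, le_rfl⟩
        simp only [sub_self, mul_zero, Real.exp_zero, mul_one]
        linarith)
      (fun x hx r hr => by
        rw [(hgd r).deriv]
        have h1 : 0 ≤ u x r ^ (k - 1) :=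
          Real.rpow_nonneg (hupos x (subset_closure hx) r hr.1.le).le _
        have h2 : 0 ≤ B * (Real.exp (A * (r - (t + 1))) * A) := by positivity
        have h3 : 0 < s ^ k * δ := mul_pos (Real.rpow_pos_of_pos hs k) hδ
        nlinarith [mul_nonneg h1 h2]) x hx t ⟨ht, by linarith⟩
    have h1 : A * (t - (t + 1)) = -A := by ring
    simp only [h1] at hcmp
    nlinarith [mul_nonneg hs.le (sq_nonneg ‖x - z‖)]
  refine le_of_forall_pos_le_add fun ε hε => ?_
  have htend : Tendsto (fun A : ℝ => B * Real.exp (-A)) atTop (nhds 0) := by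
    simpa using Real.tendsto_exp_neg_atTop_nhds_zero.const_mul B
  obtain ⟨A, hA1, hA2⟩ := ((htend.eventually_lt_const (half_pos hε)).and
    (eventually_ge_atTop 0)).exists
  have := hle (ε / 2 / V) A (by positivity) hA2
  rw [div_mul_cancel₀ _ hV.ne'] at this
  linarith

/-- If a bounded subsolution is at most `c` on the lateral boundary after time `t₀`, then it is
eventually at most `c + ε`. -/
theorem eventually_le_of_lateral_le {H : En n → Sym n → ℝ} {k₁ k : ℝ} (hk : k = k₁ + 1)
    (hk1 : 1 ≤ k)
    (hB : CondB H k₁) {Ω : Set (En n)} (hΩo : IsOpen Ω) (hΩb : Bornology.IsBounded Ω)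
    {u : En n → ℝ → ℝ}
    (husc : UpperSemicontinuousOn (fun q : En n × ℝ => u q.1 q.2) (closure Ω ×ˢ Ici (0 : ℝ)))
    (hupos : ∀ x ∈ closure Ω, ∀ t, 0 ≤ t → 0 < u x t)
    (hsub : ParSub H k (pcylInf Ω) u)
    {z : En n} {V δ : ℝ} (hV : 0 < V) (hδ : 0 < δ) (hbar : ∀ x ∈ closure Ω, ‖x - z‖ ^ 2 ≤ V ∧
      H ((-2 : ℝ) • (x - z)) ((-2 : ℝ) • (1 : Sym n)) ≤ -δ)
    {M : ℝ} (hM0 : 0 < M) (hM : ∀ x ∈ closure Ω, ∀ t, 0 ≤ t → u x t ≤ M)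
    {c t₀ : ℝ} (ht₀ : 0 ≤ t₀) (hc : ∀ x ∈ frontier Ω, ∀ t, t₀ ≤ t → u x t ≤ c)
    {ε : ℝ} (hε : 0 < ε) :
    ∃ t₁, ∀ x ∈ closure Ω, ∀ t, t₁ ≤ t → u x t ≤ c + ε := by
  set s := ε / V with hs_def
  have hs : 0 < s := by positivity
  set N := M + |c| with hN_def
  have hN : 0 < N := by positivity
  have hsk : 0 < s ^ k * δ := mul_pos (Real.rpow_pos_of_pos hs k) hδ
  set L := M ^ (k - 1) * (2 * N) / (s ^ k * δ) + 1 with hL_def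
  have hL : 0 < L := by positivity
  have hLs : M ^ (k - 1) * (2 * N / L) < s ^ k * δ := by
    rw [← mul_div_assoc, div_lt_iff₀ hL, hL_def, mul_add (s ^ k * δ), mul_div_cancel₀ _ hsk.ne']
    linarith
  refine ⟨t₀ + L, fun x hx t ht => ?_⟩
  have hgd : ∀ r : ℝ, HasDerivAt (fun r => N * ((r - t) / L) ^ 2) (2 * N / L * ((r - t) / L)) r := by
    intro r
    have h1 : HasDerivAt (fun r : ℝ => (r - t) / L) (1 / L) r :=
      ((hasDerivAt_id r).sub_const t).div_const L
    refine ((h1.pow 2).const_mul N).congr_deriv ?_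
    simp only [Nat.cast_ofNat, Nat.add_one_sub_one, pow_one]
    ring
  have hNc : M ≤ c + N := by linarith [neg_abs_le c]
  have hcmp := le_quadratic_barrier hk hB hΩo hΩb husc hsub hbar (a := t - L) (b := t + L)
    (c := c) (s := s) (by linarith) hs (g := fun r => N * ((r - t) / L) ^ 2)
    (by fun_prop) (fun r _ => by positivity)
    (fun x hx r hr => hc x hx r (by linarith [hr.1]))
    (fun x hx => by
      have h1 : (t - L - t) / L = -1 := by field_simp; ring
      simp only [h1]
      linarith [hM x hx (t - L) (by linarith)])
    (fun x hx => by
      have h1 : (t + L - t) / L = 1 := by field_simp; ring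
      simp only [h1]
      linarith [hM x hx (t + L) (by linarith)])
    (fun x hx r hr => by
      rw [(hgd r).deriv]
      have hr0 : 0 ≤ r := by linarith [hr.1]
      have hu := hupos x (subset_closure hx) r hr0
      have h1 : 0 ≤ u x r ^ (k - 1) := Real.rpow_nonneg hu.le _
      have h2 : u x r ^ (k - 1) ≤ M ^ (k - 1) :=
        Real.rpow_le_rpow hu.le (hM x (subset_closure hx) r hr0) (by linarith)
      have hNL : 0 < 2 * N / L := by positivity
      have h3 : -1 ≤ (r - t) / L := by rw [le_div_iff₀ hL]; linarith [hr.1]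
      have h4 : -(2 * N / L * ((r - t) / L)) ≤ 2 * N / L := by nlinarith
      calc u x r ^ (k - 1) * -(2 * N / L * ((r - t) / L))
          ≤ u x r ^ (k - 1) * (2 * N / L) := mul_le_mul_of_nonneg_left h4 h1
        _ ≤ M ^ (k - 1) * (2 * N / L) := mul_le_mul_of_nonneg_right h2 hNL.le
        _ < s ^ k * δ := hLs) x hx t ⟨by linarith, by linarith⟩
  have h1 : s * V = ε := div_mul_cancel₀ _ hV.ne'
  simp only [sub_self, zero_div] at hcmp
  nlinarith [mul_nonneg hs.le (sq_nonneg ‖x - z‖)]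

theorem frontier_nonempty_of_isBounded (hn : 2 ≤ n) {Ω : Set (En n)} (hΩ : Ω.Nonempty)
    (hΩb : Bornology.IsBounded Ω) : (frontier Ω).Nonempty := by
  have : Nonempty (Fin n) := ⟨⟨0, by omega⟩⟩
  rw [nonempty_iff_ne_empty]
  intro hf
  rw [← isClopen_iff_frontier_eq_empty] at hf
  rw [hf.eq_univ hΩ] at hΩb
  exact NormedSpace.unbounded_univ ℝ (En n) hΩb

/-- large time behaviour of the supremum of a positive subsolution. -/
theorem large_time_sup_subsolution
    {n : ℕ} (hn : 2 ≤ n)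
    (H : En n → Sym n → ℝ) (k₁ k : ℝ) (hk : k = k₁ + 1) (hk1 : 1 ≤ k)
    (hA : CondA H) (hB : CondB H k₁) (hC : CondC H)
    (Ω : Set (En n)) (hΩo : IsOpen Ω) (hΩc : IsConnected Ω)
    (hΩb : Bornology.IsBounded Ω)
    (h : En n → ℝ → ℝ)
    (hhc : ContinuousOn (fun q : En n × ℝ => h q.1 q.2) (pbdryInf Ω))
    (hhbddBelow : BddBelow ((fun q : En n × ℝ => h q.1 q.2) '' pbdryInf Ω))
    (hhinfpos : 0 < sInf ((fun q : En n × ℝ => h q.1 q.2) '' pbdryInf Ω))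
    (hhbddAbove : BddAbove ((fun q : En n × ℝ => h q.1 q.2) '' pbdryInf Ω))
    (u : En n → ℝ → ℝ)
    (husc : UpperSemicontinuousOn (fun q : En n × ℝ => u q.1 q.2)
      (pcylInf Ω ∪ pbdryInf Ω))
    (hupos : ∀ q ∈ pcylInf Ω ∪ pbdryInf Ω, 0 < u q.1 q.2)
    (hsub : ParSub H k (pcylInf Ω) u)
    (hleq : ∀ q ∈ pbdryInf Ω, u q.1 q.2 ≤ h q.1 q.2)
    (T : ℝ) (hT : 0 < T)
    (heq : ∀ x ∈ frontier Ω, ∀ t, T ≤ t → u x t = h x t)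
    (μsup : ℝ)
    (hμ : Filter.Tendsto
      (fun t : ℝ => sSup ((fun q : En n × ℝ => h q.1 q.2) '' (frontier Ω ×ˢ Ici t)))
      Filter.atTop (nhds μsup)) :
    Filter.Tendsto
      (fun t : ℝ => sSup ((fun q : En n × ℝ => u q.1 q.2) '' (closure Ω ×ˢ Ici t)))
      Filter.atTop (nhds μsup) := by
  rw [pcylInf_union_pbdryInf] at husc hupos
  have hupos' : ∀ x ∈ closure Ω, ∀ t, 0 ≤ t → 0 < u x t := fun x hx t ht =>
    hupos (x, t) ⟨hx, ht⟩
  obtain ⟨z, V, δ, hV, hδ, hbar⟩ := exists_strict_barrier hn hA hB hC hΩb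
  obtain ⟨M₀, hM₀⟩ := hhbddAbove
  have hhM : ∀ q ∈ pbdryInf Ω, h q.1 q.2 ≤ |M₀| + 1 := fun q hq => by
    have : h q.1 q.2 ≤ M₀ := hM₀ (mem_image_of_mem _ hq)
    linarith [le_abs_self M₀]
  have hM0 : 0 < |M₀| + 1 := by positivity
  have hM := le_of_le_on_pbdryInf hk hB hΩo hΩb husc hupos' hsub hV hδ hbar hM0.le
    fun q hq => (hleq q hq).trans (hhM q hq)
  obtain ⟨x₀, hx₀⟩ := frontier_nonempty_of_isBounded hn hΩc.nonempty hΩb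
  have hlow : ∀ t, T ≤ t → sSup ((fun q : En n × ℝ => h q.1 q.2) '' (frontier Ω ×ˢ Ici t)) ≤
      sSup ((fun q : En n × ℝ => u q.1 q.2) '' (closure Ω ×ˢ Ici t)) := by
    intro t ht
    refine csSup_le_csSup ⟨|M₀| + 1, ?_⟩ ⟨_, (x₀, t), ⟨hx₀, self_mem_Ici⟩, rfl⟩ ?_
    · rintro _ ⟨⟨x, r⟩, ⟨hx, hr⟩, rfl⟩
      exact hM x hx r (hT.le.trans (ht.trans hr))
    · rintro _ ⟨⟨x, r⟩, ⟨hx, hr⟩, rfl⟩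
      exact ⟨(x, r), ⟨frontier_subset_closure hx, hr⟩, heq x hx r (ht.trans hr)⟩
  refine tendsto_order.mpr ⟨fun a ha => ?_, fun a ha => ?_⟩
  · filter_upwards [hμ.eventually_const_lt ha, eventually_ge_atTop T] with t h1 h2
    exact h1.trans_le (hlow t h2)
  · set ε := (a - μsup) / 3 with hε_def
    have hε : 0 < ε := by rw [hε_def]; linarith
    obtain ⟨t₀, h1, h2⟩ := ((hμ.eventually_lt_const (lt_add_of_pos_right μsup hε)).and
      (eventually_ge_atTop T)).exists
    have hc : ∀ x ∈ frontier Ω, ∀ t, t₀ ≤ t → u x t ≤ μsup + ε := by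
      intro x hx t ht
      rw [heq x hx t (h2.trans ht)]
      have hbdd : BddAbove ((fun q : En n × ℝ => h q.1 q.2) '' (frontier Ω ×ˢ Ici t₀)) := by
        refine ⟨|M₀| + 1, ?_⟩
        rintro _ ⟨⟨y, r⟩, ⟨hy, hr⟩, rfl⟩
        exact hhM (y, r) (Or.inr ⟨hy, hT.le.trans (h2.trans hr)⟩)
      exact (le_csSup hbdd ⟨(x, t), ⟨hx, ht⟩, rfl⟩).trans h1.le
    obtain ⟨t₁, ht₁⟩ := eventually_le_of_lateral_le hk hk1 hB hΩo hΩb husc hupos' hsub hV hδ hbar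
      hM0 hM (hT.le.trans h2) hc hε
    filter_upwards [eventually_ge_atTop t₁] with t ht
    have hle : sSup ((fun q : En n × ℝ => u q.1 q.2) '' (closure Ω ×ˢ Ici t)) ≤
        μsup + ε + ε := by
      refine csSup_le ⟨_, (x₀, t), ⟨frontier_subset_closure hx₀, self_mem_Ici⟩, rfl⟩ ?_
      rintro _ ⟨⟨x, r⟩, ⟨hx, hr⟩, rfl⟩
      exact ht₁ x hx r (ht.trans hr)
    rw [hε_def] at hle
    linarith

end DNLP
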